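/- Let G be a nonzero FP-injective module over a chain ring R with set of zero-divisors Z. Then G^♯ ⊆ Z ∩ G_♯; consequently G is a module over the localization R_{G_♯}. -/

import Mathlib

open CategoryTheory

universe u

/-- A chain ring: the lattice of ideals is totally ordered by inclusion. -/
def IsChainRing (R : Type u) [CommRing R] : Prop :=
  ∀ I J : Ideal R, I ≤ J ∨ J ≤ I

/-- The set of zero-divisors of `R`. -/
def zeroDivisorsSet (R : Type u) [CommRing R] : Set R :=
  {r : R | ∃ s : R, s ≠ 0 ∧ r * s = 0}

/-- An `R`-module `E` is FP-injective if `Ext¹_R(F, E) = 0` for every finitely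
presented `R`-module `F`. -/
def IsFPInjective (R : Type u) [CommRing R] (E : Type u) [AddCommGroup E] [Module R E] : Prop :=
  ∀ F : ModuleCat.{u} R, Module.FinitePresentation R F →
    Limits.IsZero (((Ext R (ModuleCat.{u} R) 1).obj (Opposite.op F)).obj (ModuleCat.of R E))

/-- A submodule `D ≤ E` is pure if `0 → D ⊗ N → E ⊗ N` is exact for every module `N`,
i.e. the sequence `0 → D → E → E/D → 0` remains exact after tensoring with any module. -/
def IsPureSubmodule {R : Type u} [CommRing R] {E : Type u} [AddCommGroup E] [Module R E]
    (D : Submodule R E) : Prop :=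
  ∀ (N : Type u) [AddCommGroup N] [Module R N],
    Function.Injective (LinearMap.rTensor N D.subtype)

/-- An `R`-module `G` is almost FP-injective if `G ≅ E/D` for some FP-injective module `E`
and pure submodule `D` of `E`. -/
def IsAlmostFPInjective (R : Type u) [CommRing R] (G : Type u) [AddCommGroup G]
    [Module R G] : Prop :=
  ∃ (E : Type u) (_ : AddCommGroup E) (_ : Module R E) (D : Submodule R E),
    IsFPInjective R E ∧ IsPureSubmodule D ∧ Nonempty ((E ⧸ D) ≃ₗ[R] G)

/-- The weak dimension of a module, as an element of `ℕ∞`: the least `n` such that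
`Tor_{n+1}(M, N) = 0` for all modules `N` (and `⊤ = ∞` if there is no such `n`). -/
noncomputable def weakDim (R : Type u) [CommRing R] (M : Type u) [AddCommGroup M]
    [Module R M] : ℕ∞ :=
  sInf {n : ℕ∞ | ∃ k : ℕ, n = k ∧ ∀ N : ModuleCat.{u} R,
    Limits.IsZero (((Tor (ModuleCat.{u} R) (k + 1)).obj (ModuleCat.of R M)).obj N)}

/-- The projective dimension of a module, as an element of `ℕ∞`: the least `n` such that
`Ext^{n+1}(M, N) = 0` for all modules `N` (and `⊤ = ∞` if there is no such `n`). -/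
noncomputable def projDim (R : Type u) [CommRing R] (M : Type u) [AddCommGroup M]
    [Module R M] : ℕ∞ :=
  sInf {n : ℕ∞ | ∃ k : ℕ, n = k ∧ ∀ N : ModuleCat.{u} R,
    Limits.IsZero (((Ext R (ModuleCat.{u} R) (k + 1)).obj
      (Opposite.op (ModuleCat.of R M))).obj N)}

/-- An IF-ring: every injective module is flat. -/
def IsIFRing (R : Type u) [CommRing R] : Prop :=
  ∀ (M : Type u) [AddCommGroup M] [Module R M], Module.Injective R M → Module.Flat R M

/-- A semicoherent ring: `Hom_R(E, F)` embeds into a flat module for every pair of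
injective modules `E`, `F`. -/
def IsSemicoherent (R : Type u) [CommRing R] : Prop :=
  ∀ (E F : Type u) [AddCommGroup E] [Module R E] [AddCommGroup F] [Module R F],
    Module.Injective R E → Module.Injective R F →
      ∃ (W : Type u) (_ : AddCommGroup W) (_ : Module R W),
        Module.Flat R W ∧ ∃ f : (E →ₗ[R] F) →ₗ[R] W, Function.Injective f

/-- A coherent ring: every finitely generated ideal is finitely presented. -/
def IsCoherentRing (R : Type u) [CommRing R] : Prop :=
  ∀ I : Ideal R, I.FG → Module.FinitePresentation R I

/-- `i : M →ₗ[R] E` exhibits `E` as an injective hull of `M`: `E` is injective and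
`i` is an essential embedding. -/
def IsInjectiveHull (R : Type u) [CommRing R] (M E : Type u) [AddCommGroup M] [Module R M]
    [AddCommGroup E] [Module R E] (i : M →ₗ[R] E) : Prop :=
  Module.Injective R E ∧ Function.Injective i ∧
    ∀ K : Submodule R E, K ≠ ⊥ → K ⊓ LinearMap.range i ≠ ⊥

/-- The bottom prime ideal `M_♯` (as a set): elements killing some nonzero element of `M`. -/
def bottomSet (R : Type u) [CommRing R] (M : Type u) [AddCommGroup M] [Module R M] : Set R :=
  {s : R | ∃ x : M, x ≠ 0 ∧ s • x = 0}

/-- The top prime ideal `M^♯` (as a set): elements `s` with `sM ⊊ M`. -/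
def topSet (R : Type u) [CommRing R] (M : Type u) [AddCommGroup M] [Module R M] : Set R :=
  {s : R | ¬ Function.Surjective fun x : M => s • x}

/-- If `Ext¹(X, Y) = 0`, every 1-cocycle on a projective resolution of `X` with values in `Y`
is a coboundary. -/
theorem CategoryTheory.ProjectiveResolution.exists_d_comp_eq_of_isZero_ext {R : Type u}
    [CommRing R] {X : ModuleCat.{u} R} (P : ProjectiveResolution X) (Y : ModuleCat.{u} R)
    (hY : Limits.IsZero (((Ext R (ModuleCat.{u} R) 1).obj (Opposite.op X)).obj Y))
    (g : P.complex.X 1 ⟶ Y) (hg : P.complex.d 2 1 ≫ g = 0) :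
    ∃ h : P.complex.X 0 ⟶ Y, P.complex.d 1 0 ≫ h = g := by
  have hz := hY.of_iso (P.isoExt (R := R) 1 Y).symm
  rw [← HomologicalComplex.exactAt_iff_isZero_homology,
    HomologicalComplex.exactAt_iff' _ 0 1 2 (by simp) (by simp),
    ShortComplex.moduleCat_exact_iff] at hz
  exact hz g hg

/-- If `Ext¹(R ⧸ I, G) = 0`, every linear map from the ideal `I` to `G` is given by multiplication
with an element of `G`. -/
theorem Ideal.exists_smul_eq_of_isZero_ext {R : Type u} [CommRing R] {G : Type u}
    [AddCommGroup G] [Module R G] (I : Ideal R)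
    (hI : Limits.IsZero (((Ext R (ModuleCat.{u} R) 1).obj
      (Opposite.op (ModuleCat.of R (R ⧸ I)))).obj (ModuleCat.of R G)))
    (f : I →ₗ[R] G) : ∃ e : G, ∀ a : I, (a : R) • e = f a := by
  let P := projectiveResolution (ModuleCat.of R (R ⧸ I))
  let ε : P.complex.X 0 ⟶ ModuleCat.of R (R ⧸ I) := P.π.f 0
  have hdε : P.complex.d 1 0 ≫ ε = 0 := P.complex_d_comp_π_f_zero
  have hexact : ∀ p, ε p = 0 → ∃ q, P.complex.d 1 0 q = p :=
    (ShortComplex.moduleCat_exact_iff _).1 P.exact₀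
  let mk : ModuleCat.of R R ⟶ ModuleCat.of R (R ⧸ I) := ModuleCat.ofHom I.mkQ
  have : Epi mk := (ModuleCat.epi_iff_surjective _).2 I.mkQ_surjective
  let φ : P.complex.X 0 ⟶ ModuleCat.of R R := Projective.factorThru ε mk
  have hφ : ∀ p, I.mkQ (φ p) = ε p := fun p =>
    ConcreteCategory.congr_hom (Projective.factorThru_comp ε mk) p
  have hφd : ∀ q, φ (P.complex.d 1 0 q) ∈ I := fun q => by
    have h0 : ε (P.complex.d 1 0 q) = 0 := ConcreteCategory.congr_hom hdε q
    rw [← hφ] at h0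
    exact (Submodule.Quotient.mk_eq_zero I).1 h0
  let g : P.complex.X 1 ⟶ ModuleCat.of R G := ModuleCat.ofHom
    (f ∘ₗ (φ.hom ∘ₗ (P.complex.d 1 0).hom).codRestrict I hφd)
  have hg : P.complex.d 2 1 ≫ g = 0 := by
    ext q
    have hdd : P.complex.d 1 0 (P.complex.d 2 1 q) = 0 :=
      ConcreteCategory.congr_hom (P.complex.d_comp_d 2 1 0) q
    change f ⟨φ (P.complex.d 1 0 (P.complex.d 2 1 q)), _⟩ = 0
    rw [← f.map_zero]
    congr 1
    ext
    change φ (P.complex.d 1 0 (P.complex.d 2 1 q)) = 0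
    rw [hdd, map_zero]
  obtain ⟨h, hh⟩ := P.exists_d_comp_eq_of_isZero_ext _ hI g hg
  have hdh : ∀ q, h (P.complex.d 1 0 q) = f ⟨φ (P.complex.d 1 0 q), hφd q⟩ :=
    fun q => ConcreteCategory.congr_hom hh q
  have : Epi ε := inferInstanceAs (Epi (P.π.f 0))
  obtain ⟨p, hp⟩ := (ModuleCat.epi_iff_surjective ε).1 inferInstance (I.mkQ 1)
  have hi : φ p - 1 ∈ I := by
    rw [← Submodule.Quotient.mk_eq_zero I]
    have := hφ p
    rw [hp] at this
    exact (map_sub I.mkQ (φ p) 1).trans (sub_eq_zero.2 this)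
  refine ⟨h p - f ⟨φ p - 1, hi⟩, fun a => ?_⟩
  obtain ⟨q, hq⟩ := hexact ((a : R) • p) (by
    rw [map_smul, hp, ← map_smul]
    exact (Submodule.Quotient.mk_eq_zero I).2 (by simp))
  have hhp : (a : R) • h p = f ⟨φ (P.complex.d 1 0 q), hφd q⟩ := by
    rw [← hdh, hq, map_smul]
  rw [smul_sub, hhp, ← map_smul, ← map_sub]
  congr 1
  ext
  have hφq : φ (P.complex.d 1 0 q) = (a : R) * φ p := by
    rw [hq, map_smul]; rfl
  change φ (P.complex.d 1 0 q) - (a : R) * (φ p - 1) = a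
  rw [hφq]
  ring

/-- In an FP-injective module, `x` is divisible by `s` as soon as the annihilator of `s`
kills `x`. -/
theorem IsFPInjective.exists_smul_eq {R : Type u} [CommRing R] {G : Type u} [AddCommGroup G]
    [Module R G] (hG : IsFPInjective R G) {s : R} {x : G}
    (hsx : ∀ r : R, r * s = 0 → r • x = 0) : ∃ y : G, s • y = x := by
  let m : R →ₗ[R] R := LinearMap.toSpanSingleton R R s
  let I : Ideal R := LinearMap.range m
  have hker : LinearMap.ker m ≤ LinearMap.ker (LinearMap.toSpanSingleton R G x) := hsx
  let f : I →ₗ[R] G :=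
    (LinearMap.ker m).liftQ (LinearMap.toSpanSingleton R G x) hker ∘ₗ
      m.quotKerEquivRange.symm.toLinearMap
  have hI : Submodule.FG (I : Submodule R R) :=
    (Module.Finite.iff_fg).1 (Module.Finite.range m)
  have : Module.FinitePresentation R (R ⧸ I) :=
    Module.finitePresentation_of_surjective I.mkQ I.mkQ_surjective (by rwa [Submodule.ker_mkQ])
  obtain ⟨e, he⟩ := I.exists_smul_eq_of_isZero_ext (hG (ModuleCat.of R (R ⧸ I)) ‹_›) f
  have hm : m 1 = s := one_smul R s
  refine ⟨e, ?_⟩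
  have h1 := he ⟨m 1, LinearMap.mem_range_self m 1⟩
  have h2 : m.quotKerEquivRange.symm ⟨m 1, LinearMap.mem_range_self m 1⟩ =
      (LinearMap.ker m).mkQ 1 := m.quotKerEquivRange_symm_apply_image 1 _
  change m 1 • e = (LinearMap.ker m).liftQ _ hker (m.quotKerEquivRange.symm _) at h1
  rw [h2, hm, Submodule.mkQ_apply, Submodule.liftQ_apply] at h1
  simpa using h1

/-- Multiplication by `s` is surjective on an FP-injective module on which it is injective. -/
theorem IsFPInjective.surjective_smul_of_notMem_bottomSet {R : Type u} [CommRing R] {G : Type u}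
    [AddCommGroup G] [Module R G] (hG : IsFPInjective R G) {s : R} (hs : s ∉ bottomSet R G) :
    Function.Surjective fun x : G => s • x := fun x =>
  hG.exists_smul_eq fun r hr => by
    by_contra hrx
    exact hs ⟨r • x, hrx, by rw [smul_smul, mul_comm, hr, zero_smul]⟩

/-- If `G` is a nonzero FP-injective module over a chain ring `R`,
then `G^♯ ⊆ Z ∩ G_♯`; consequently `G` is a module over `R_{G_♯}` (i.e. multiplication
by any `s ∉ G_♯` is bijective on `G`). -/
theorem topSet_subset_of_fpInjective (R : Type u) [CommRing R] (hR : IsChainRing R)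
    (G : Type u) [AddCommGroup G] [Module R G] [Nontrivial G]
    (hG : IsFPInjective R G) :
    topSet R G ⊆ zeroDivisorsSet R ∩ bottomSet R G ∧
      ∀ s : R, s ∉ bottomSet R G → Function.Bijective fun x : G => s • x := by
  refine ⟨fun s hs => ⟨?_, ?_⟩, fun s hs => ⟨fun x y hxy => ?_, ?_⟩⟩
  · by_contra hZ
    refine hs fun x => hG.exists_smul_eq fun r hr => ?_
    have : r = 0 := by
      by_contra hr0
      exact hZ ⟨r, hr0, by rw [mul_comm, hr]⟩
    rw [this, zero_smul]
  · by_contra hb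
    exact hs (hG.surjective_smul_of_notMem_bottomSet hb)
  · by_contra hne
    exact hs ⟨x - y, sub_ne_zero.2 hne, by rw [smul_sub]; exact sub_eq_zero.2 hxy⟩
  · exact hG.surjective_smul_of_notMem_bottomSet hs
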